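/- Let G = (V,E,w) be a connected weighted graph with positive weights, and assign to each edge e = {u,v} the quantity q_e = w_e · R_eff(u,v), where R_eff is the effective resistance (u,v) ↦ (1_u − 1_v)ᵀ L⁺ (1_u − 1_v) with L the weighted Laplacian. Then for every nonempty subset S ⊆ V, the sum of q_e over edges e induced by S is at most |S| − 1. In particular, the weighted graph with edge weights q_e has subset density at most 1. -/

import Mathlib

open scoped Classical
open Finset Matrix

/-- Laplacian of the subgraph induced by `S`. -/
noncomputable def lapS {V : Type*} [Fintype V] [DecidableEq V] (G : SimpleGraph V)
    (w : Sym2 V → ℝ) (S : Finset V) : Matrix V V ℝ :=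
  (1 / 2 : ℝ) • ∑ u ∈ S, ∑ v ∈ S,
      (if G.Adj u v then w s(u, v) •
        vecMulVec ((Pi.single u 1 : V → ℝ) - Pi.single v 1)
          ((Pi.single u 1 : V → ℝ) - Pi.single v 1) else 0)

section aux
variable {V : Type*} [Fintype V] [DecidableEq V] (G : SimpleGraph V)
    (w : Sym2 V → ℝ) (S : Finset V)

lemma lapS_transpose : (lapS G w S)ᵀ = lapS G w S := by
  unfold lapS
  simp only [transpose_smul, transpose_sum]
  congr 1
  refine sum_congr rfl fun u _ => sum_congr rfl fun v _ => ?_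
  split_ifs <;> simp [transpose_vecMulVec]

lemma lapS_mulVec (x : V → ℝ) : lapS G w S *ᵥ x = (1 / 2 : ℝ) • ∑ u ∈ S, ∑ v ∈ S,
      (if G.Adj u v then (w s(u, v) * (x u - x v)) •
        ((Pi.single u 1 : V → ℝ) - Pi.single v 1) else 0) := by
  unfold lapS
  simp only [smul_mulVec, sum_mulVec]
  congr 1
  refine sum_congr rfl fun u _ => sum_congr rfl fun v _ => ?_
  split_ifs
  · rw [smul_mulVec, vecMulVec_mulVec, sub_dotProduct]
    ext i
    simp
    ring
  · simp

lemma lapS_quad (x : V → ℝ) : x ⬝ᵥ lapS G w S *ᵥ x = (1 / 2 : ℝ) * ∑ u ∈ S, ∑ v ∈ S,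
      (if G.Adj u v then w s(u, v) * (x u - x v) ^ 2 else 0) := by
  rw [lapS_mulVec, dotProduct_smul, smul_eq_mul]
  congr 1
  rw [dotProduct_sum]
  refine sum_congr rfl fun u _ => ?_
  rw [dotProduct_sum]
  refine sum_congr rfl fun v _ => ?_
  split_ifs
  · rw [dotProduct_smul, dotProduct_sub]
    simp
    ring
  · simp

lemma lapS_term_nonneg (hw : ∀ e ∈ G.edgeSet, 0 < w e) (x : V → ℝ) (u v : V) :
    0 ≤ (if G.Adj u v then w s(u, v) * (x u - x v) ^ 2 else 0) := by
  split_ifs with h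
  · exact mul_nonneg (hw _ h).le (sq_nonneg _)
  · exact le_rfl

lemma lapS_nonneg (hw : ∀ e ∈ G.edgeSet, 0 < w e) (x : V → ℝ) :
    0 ≤ x ⬝ᵥ lapS G w S *ᵥ x := by
  rw [lapS_quad]
  exact mul_nonneg (by norm_num) (sum_nonneg fun u _ => sum_nonneg fun v _ =>
    lapS_term_nonneg G w hw x u v)

lemma lapS_le (hw : ∀ e ∈ G.edgeSet, 0 < w e) (x : V → ℝ) :
    x ⬝ᵥ lapS G w S *ᵥ x ≤ x ⬝ᵥ lapS G w univ *ᵥ x := by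
  rw [lapS_quad, lapS_quad]
  refine mul_le_mul_of_nonneg_left ?_ (by norm_num)
  calc _ ≤ ∑ u ∈ S, ∑ v, (if G.Adj u v then w s(u, v) * (x u - x v) ^ 2 else 0) :=
        sum_le_sum fun u _ => sum_le_sum_of_subset_of_nonneg (subset_univ _)
          fun v _ _ => lapS_term_nonneg G w hw x u v
    _ ≤ _ := sum_le_sum_of_subset_of_nonneg (subset_univ _) fun u _ _ =>
          sum_nonneg fun v _ => lapS_term_nonneg G w hw x u v

lemma lapS_rank (hS : S.Nonempty) : (lapS G w S).rank + 1 ≤ S.card := by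
  obtain ⟨s, hs⟩ := hS
  let f : V → (V → ℝ) := fun u => Pi.single u 1 - Pi.single s 1
  let T : Finset (V → ℝ) := (S.erase s).image f
  have hf : ∀ u ∈ S, f u ∈ Submodule.span ℝ (T : Set (V → ℝ)) := by
    intro u hu
    by_cases h : u = s
    · subst h; simp [f]
    · exact Submodule.subset_span (mem_coe.2 (mem_image_of_mem f (mem_erase.2 ⟨h, hu⟩)))
  have hle : LinearMap.range (lapS G w S).mulVecLin ≤ Submodule.span ℝ (T : Set (V → ℝ)) := by
    rintro _ ⟨x, rfl⟩
    rw [mulVecLin_apply, lapS_mulVec]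
    refine Submodule.smul_mem _ _ (Submodule.sum_mem _ fun u hu => Submodule.sum_mem _
      fun v hv => ?_)
    split_ifs
    · refine Submodule.smul_mem _ _ ?_
      have : (Pi.single u 1 : V → ℝ) - Pi.single v 1 = f u - f v := by simp [f]
      rw [this]
      exact Submodule.sub_mem _ (hf u hu) (hf v hv)
    · exact Submodule.zero_mem _
  have h1 : (lapS G w S).rank ≤ T.card :=
    (Submodule.finrank_mono hle).trans (finrank_span_finset_le_card T)
  have h2 : T.card ≤ (S.erase s).card := card_image_le
  have h3 := card_erase_add_one hs
  omega

lemma trace_lapS (K : Matrix V V ℝ) (q : Sym2 V → ℝ)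
    (hq : ∀ u v : V, G.Adj u v → q s(u, v)
      = w s(u, v) * (((Pi.single u 1 : V → ℝ) - Pi.single v 1) ⬝ᵥ
          K.mulVec ((Pi.single u 1 : V → ℝ) - Pi.single v 1))) :
    (1 / 2 : ℝ) * ∑ u ∈ S, ∑ v ∈ S, (if G.Adj u v then q s(u, v) else 0)
      = (K * lapS G w S).trace := by
  unfold lapS
  rw [mul_smul_comm, trace_smul, smul_eq_mul]
  congr 1
  rw [Matrix.mul_sum, trace_sum]
  refine sum_congr rfl fun u _ => ?_
  rw [Matrix.mul_sum, trace_sum]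
  refine sum_congr rfl fun v _ => ?_
  split_ifs with h
  · rw [hq u v h, mul_smul_comm, trace_smul, smul_eq_mul, mul_vecMulVec, trace_vecMulVec,
      dotProduct_comm]
  · simp

/-- The trace bound from `A K A ≤ A`. -/
lemma trace_le_rank (A K : Matrix V V ℝ) (hA : A.IsHermitian)
    (hpos : ∀ x, 0 ≤ x ⬝ᵥ A *ᵥ x)
    (h : ∀ x, (A *ᵥ x) ⬝ᵥ K *ᵥ (A *ᵥ x) ≤ x ⬝ᵥ A *ᵥ x) :
    (K * A).trace ≤ A.rank := by
  let v : V → V → ℝ := fun i => (hA.eigenvectorBasis i).ofLp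
  have hv : ∀ i, A *ᵥ v i = hA.eigenvalues i • v i := hA.mulVec_eigenvectorBasis
  have hn : ∀ i, v i ⬝ᵥ v i = 1 := by
    intro i
    have := hA.eigenvectorBasis.orthonormal.1 i
    have h2 := real_inner_self_eq_norm_sq (hA.eigenvectorBasis i)
    rw [this, EuclideanSpace.inner_eq_star_dotProduct] at h2
    simpa [v] using h2
  have htr : (K * A).trace = ∑ i, hA.eigenvalues i * (v i ⬝ᵥ K *ᵥ v i) := by
    have hL := LinearMap.trace_eq_sum_inner (toLpLin 2 2 (K * A)) hA.eigenvectorBasis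
    have ht : LinearMap.trace ℝ _ (toLpLin 2 2 (K * A)) = (K * A).trace := by
      rw [toLpLin_eq_toLin, Matrix.trace_toLin_eq]
    rw [← ht, hL]
    refine sum_congr rfl fun i _ => ?_
    rw [EuclideanSpace.inner_eq_star_dotProduct]
    simp only [ofLp_toLpLin, toLin'_apply, star_trivial]
    change (K * A) *ᵥ v i ⬝ᵥ v i = _
    rw [← mulVec_mulVec, hv, mulVec_smul, smul_dotProduct, smul_eq_mul, dotProduct_comm]
  have hterm : ∀ i, hA.eigenvalues i * (v i ⬝ᵥ K *ᵥ v i)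
      ≤ if hA.eigenvalues i ≠ 0 then 1 else 0 := by
    intro i
    split_ifs with h0
    · have hp := hpos (v i)
      have hh := h (v i)
      simp only [hv, mulVec_smul, smul_dotProduct, dotProduct_smul, smul_eq_mul, hn] at hp hh
      have : 0 < hA.eigenvalues i := lt_of_le_of_ne (by linarith) (Ne.symm h0)
      exact le_of_mul_le_mul_left (by linarith) this
    · push Not at h0
      simp [h0]
  rw [htr, hA.rank_eq_card_non_zero_eigs]
  refine (sum_le_sum fun i _ => hterm i).trans ?_
  rw [Finset.sum_boole, Fintype.card_subtype]

lemma pinv_aux (L K : Matrix V V ℝ) (hL : Lᵀ = L)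
    (h1 : L * K * L = L) (h2 : K * L * K = K)
    (h3 : (L * K)ᵀ = L * K) (h4 : (K * L)ᵀ = K * L) : Kᵀ * L * K = Kᵀ := by
  have h3' : Kᵀ * L = L * K := by rw [← h3, transpose_mul, hL]
  have h4' : L * Kᵀ = K * L := by rw [← h4, transpose_mul, hL]
  have h1' : L * Kᵀ * L = L := by
    have := congrArg transpose h1
    simpa [transpose_mul, hL, Matrix.mul_assoc] using this
  have h2' : Kᵀ * L * Kᵀ = Kᵀ := by
    have := congrArg transpose h2
    simpa [transpose_mul, hL, Matrix.mul_assoc] using this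
  have e1 : L * K = (K * L) * (L * K) := by
    rw [← h4', ← Matrix.mul_assoc, h1']
  have e2 : L * K = (L * K) * (K * L) := by
    have := congrArg transpose e1
    rwa [transpose_mul (K * L), h3, h4] at this
  have e3 : (L * K) * (K * L) = K * L := by
    rw [← h4', ← Matrix.mul_assoc, h1]
  have e4 : L * K = K * L := e2.trans e3
  rw [Matrix.mul_assoc, e4, ← h4', ← Matrix.mul_assoc, h2']

end aux

/-- For a connected weighted graph with positive weights, assigning each edge
`e = {u,v}` the weight `q_e = w_e R_eff(u,v) = w_e (1_u - 1_v)ᵀ L⁺ (1_u - 1_v)`,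
every nonempty `S ⊆ V` satisfies `∑_{e ∈ E(S)} q_e ≤ |S| - 1`; in particular the
weighted subset density under `q` is at most `1`. -/
theorem stmt1 {V : Type*} [Fintype V] [DecidableEq V]
    (G : SimpleGraph V) (hG : G.Connected)
    (w : Sym2 V → ℝ) (hw : ∀ e ∈ G.edgeSet, 0 < w e)
    (L : Matrix V V ℝ)
    (hL : L = (1 / 2 : ℝ) • ∑ u : V, ∑ v : V,
      (if G.Adj u v then w s(u, v) •
        vecMulVec ((Pi.single u 1 : V → ℝ) - Pi.single v 1)
          ((Pi.single u 1 : V → ℝ) - Pi.single v 1) else 0))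
    (Lp : Matrix V V ℝ)
    (h1 : L * Lp * L = L) (h2 : Lp * L * Lp = Lp)
    (h3 : (L * Lp)ᵀ = L * Lp) (h4 : (Lp * L)ᵀ = Lp * L)
    (q : Sym2 V → ℝ)
    (hq : ∀ u v : V, G.Adj u v → q s(u, v)
      = w s(u, v) * (((Pi.single u 1 : V → ℝ) - Pi.single v 1) ⬝ᵥ
          Lp.mulVec ((Pi.single u 1 : V → ℝ) - Pi.single v 1)))
    (S : Finset V) (hS : S.Nonempty) :
    ((1 / 2 : ℝ) * ∑ u ∈ S, ∑ v ∈ S, (if G.Adj u v then q s(u, v) else 0)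
        ≤ (S.card : ℝ) - 1) ∧
    ((1 / 2 : ℝ) * ∑ u ∈ S, ∑ v ∈ S, (if G.Adj u v then q s(u, v) else 0)
        ≤ (S.card : ℝ)) := by
  have hLl : L = lapS G w univ := hL
  have hquad : ∀ x, (lapS G w S *ᵥ x) ⬝ᵥ Lp *ᵥ (lapS G w S *ᵥ x) ≤ x ⬝ᵥ lapS G w S *ᵥ x := by
    intro x
    have hK := pinv_aux L Lp (by rw [hLl]; exact lapS_transpose G w univ) h1 h2 h3 h4
    have hAt := lapS_transpose G w S
    have hle := lapS_le G w S hw (Lp *ᵥ (lapS G w S *ᵥ x))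
    have hnn := lapS_nonneg G w S hw (x - Lp *ᵥ (lapS G w S *ᵥ x))
    rw [← hLl] at hle
    generalize lapS G w S = A at *
    have key : (Lp *ᵥ (A *ᵥ x)) ⬝ᵥ L *ᵥ (Lp *ᵥ (A *ᵥ x)) = (A *ᵥ x) ⬝ᵥ Lp *ᵥ (A *ᵥ x) := by
      generalize A *ᵥ x = z
      calc (Lp *ᵥ z) ⬝ᵥ L *ᵥ (Lp *ᵥ z) = z ⬝ᵥ (Lpᵀ * L * Lp) *ᵥ z := by
            rw [← mulVec_mulVec, ← mulVec_mulVec, dotProduct_mulVec z, vecMul_transpose]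
        _ = z ⬝ᵥ Lp *ᵥ z := by
            rw [hK, dotProduct_mulVec, vecMul_transpose, dotProduct_comm]
    have hsym : ∀ y, x ⬝ᵥ A *ᵥ y = (A *ᵥ x) ⬝ᵥ y := by
      intro y
      rw [dotProduct_mulVec, ← mulVec_transpose, hAt]
    rw [mulVec_sub, dotProduct_sub, sub_dotProduct, sub_dotProduct, hsym (Lp *ᵥ _),
      dotProduct_comm (Lp *ᵥ (A *ᵥ x)) (A *ᵥ x)] at hnn
    linarith
  have hH : (lapS G w S).IsHermitian := by
    rw [Matrix.IsHermitian, conjTranspose_eq_transpose_of_trivial]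
    exact lapS_transpose G w S
  have ht := trace_le_rank (lapS G w S) Lp hH (lapS_nonneg G w S hw) hquad
  rw [← trace_lapS G w S Lp q hq] at ht
  have hr : ((lapS G w S).rank : ℝ) + 1 ≤ S.card := by exact_mod_cast lapS_rank G w S hS
  constructor
  · linarith
  · linarith
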